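/- The family (m_ρ/(ρ(1−ρ)))_ρ, indexed by the nontrivial zeros ρ of the Riemann zeta function with multiplicities m_ρ, is summable, and Σ_ρ m_ρ/(ρ(1−ρ)) = 2 + γ − log(4π), where γ is the Euler–Mascheroni constant. Equivalently, the symmetrically paired sum of 1/ρ over the nontrivial zeros equals −B, where B = (1/2)·log(4π) − 1 − γ/2. -/

import Mathlib

open Real

/-- The multiplicity (order of vanishing) of the Riemann zeta function at a point `ρ`:
the least `n` such that the `n`-th derivative of `ζ` at `ρ` is nonzero. -/
noncomputable def zetaZeroMultiplicity (ρ : ℂ) : ℕ :=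
  sInf {n : ℕ | iteratedDeriv n riemannZeta ρ ≠ 0}

open Filter Topology Metric

/-- The derivative of `log g` varies slowly near the origin when `g` is zero-free with
controlled growth on a large disc. -/
lemma norm_logDeriv_one_sub_logDeriv_zero_le {g : ℂ → ℂ} {R A : ℝ} (hg : Differentiable ℂ g)
    (hR : 8 ≤ R) (hA : 0 < A) (h0 : g 0 = 1) (hne : ∀ z ∈ ball (0 : ℂ) R, g z ≠ 0)
    (hb : ∀ z ∈ ball (0 : ℂ) R, ‖g z‖ ≤ Real.exp A) :
    ‖logDeriv g 1 - logDeriv g 0‖ ≤ 64 * A / R ^ 2 := by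
  have hdg : Differentiable ℂ (deriv g) := fun z ↦ (hg.analyticAt z).deriv.differentiableAt
  have hld : DifferentiableOn ℂ (logDeriv g) (ball 0 R) := fun z hz ↦
    ((hdg z).div (hg z) (hne z hz)).differentiableWithinAt
  obtain ⟨L, hL0, hL⟩ := hld.isExactOn_ball.with_val_at 0 0
  have hexp : ∀ z ∈ ball (0 : ℂ) R, Complex.exp (L z) = g z := by
    have hd : ∀ z ∈ ball (0 : ℂ) R, HasDerivAt (fun z ↦ g z * Complex.exp (-L z)) 0 z := by
      intro z hz
      refine ((hg z).hasDerivAt.mul ((hL z hz).fun_neg.cexp)).congr_deriv ?_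
      rw [logDeriv_apply]
      field_simp [hne z hz]
      ring
    intro z hz
    have hconst := (convex_ball (0 : ℂ) R).is_const_of_fderivWithin_eq_zero (𝕜 := ℂ)
      (f := fun z ↦ g z * Complex.exp (-L z))
      (fun w hw ↦ (hd w hw).differentiableAt.differentiableWithinAt)
      (fun w hw ↦ by
        rw [fderivWithin_of_isOpen isOpen_ball hw]
        ext
        simpa using (hd w hw).deriv) hz (mem_ball_self (by linarith))
    simp only [hL0, h0, neg_zero, Complex.exp_zero, mul_one] at hconst
    rw [Complex.exp_neg, mul_inv_eq_one₀ (Complex.exp_ne_zero _)] at hconst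
    exact hconst.symm
  have hLd : DifferentiableOn ℂ L (ball 0 R) := fun z hz ↦
    (hL z hz).differentiableAt.differentiableWithinAt
  have hre : Set.MapsTo L (ball 0 R) {z | z.re ≤ A} := by
    intro z hz
    have := hb z hz
    rw [← hexp z hz, Complex.norm_exp, Real.exp_le_exp] at this
    exact this
  have hR0 : 0 < R := by linarith
  have hLb : ∀ z ∈ closedBall (0 : ℂ) (R / 2), ‖L z‖ ≤ 2 * A := by
    intro z hz
    rw [mem_closedBall_zero_iff] at hz
    refine (Complex.borelCaratheodory_zero hA hLd hre hR0
      (mem_ball_zero_iff.2 (by linarith)) hL0).trans ?_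
    rw [div_le_iff₀ (by linarith)]
    nlinarith
  have hball : ∀ {z w : ℂ} {r s : ℝ}, z ∈ closedBall (0 : ℂ) r → w ∈ closedBall z s →
      w ∈ closedBall (0 : ℂ) (r + s) := by
    intro z w r s hz hw
    rw [mem_closedBall] at *
    linarith [dist_triangle w z 0]
  have hldb : ∀ z ∈ closedBall (0 : ℂ) (R / 4), ‖logDeriv g z‖ ≤ 8 * A / R := by
    intro z hz
    have hsub : ∀ w ∈ closedBall z (R / 4), w ∈ closedBall (0 : ℂ) (R / 2) := fun w hw ↦ by
      have := hball hz hw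
      rwa [show R / 4 + R / 4 = R / 2 by ring] at this
    have := Complex.norm_deriv_le_of_forall_mem_sphere_norm_le (c := z) (R := R / 4) (C := 2 * A)
      (f := L) (by linarith)
      ((hLd.mono fun w hw ↦
        closedBall_subset_ball (by linarith) (hsub w hw)).diffContOnCl_ball subset_rfl)
      (fun w hw ↦ hLb w (hsub w (sphere_subset_closedBall hw)))
    rw [(hL z (closedBall_subset_ball (by linarith) hz)).deriv] at this
    refine this.trans_eq ?_
    field_simp
    ring
  have hd2 : ∀ z ∈ closedBall (0 : ℂ) (R / 8), ‖deriv (logDeriv g) z‖ ≤ 64 * A / R ^ 2 := by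
    intro z hz
    have hsub : ∀ w ∈ closedBall z (R / 8), w ∈ closedBall (0 : ℂ) (R / 4) := fun w hw ↦ by
      have := hball hz hw
      rwa [show R / 8 + R / 8 = R / 4 by ring] at this
    have := Complex.norm_deriv_le_of_forall_mem_sphere_norm_le (c := z) (R := R / 8)
      (C := 8 * A / R) (f := logDeriv g) (by linarith)
      ((hld.mono fun w hw ↦
        closedBall_subset_ball (by linarith) (hsub w hw)).diffContOnCl_ball subset_rfl)
      (fun w hw ↦ hldb w (hsub w (sphere_subset_closedBall hw)))
    refine this.trans_eq ?_
    field_simp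
    ring
  have := (convex_closedBall (0 : ℂ) (R / 8)).norm_image_sub_le_of_norm_deriv_le
    (f := logDeriv g) (x := 0) (y := 1) (C := 64 * A / R ^ 2)
    (fun z hz ↦ (hld z (closedBall_subset_ball (by linarith) hz)).differentiableAt
      (isOpen_ball.mem_nhds (closedBall_subset_ball (by linarith) hz)))
    hd2 (by simp; linarith) (by simp; linarith)
  simpa using this

/-- A zero of an entire function can be divided out, leaving an entire function. -/
lemma exists_differentiable_eq_pow_mul {f : ℂ → ℂ} (hf : Differentiable ℂ f) {a : ℂ}
    (ha : analyticOrderAt f a ≠ ⊤) :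
    ∃ g : ℂ → ℂ, Differentiable ℂ g ∧ g a ≠ 0 ∧
      ∀ z, f z = (z - a) ^ analyticOrderNatAt f a * g z := by
  obtain ⟨g, hga, hg0, hfg⟩ := (hf.analyticAt a).analyticOrderAt_ne_top.1 ha
  set n := analyticOrderNatAt f a
  let G : ℂ → ℂ := Function.update (fun z ↦ f z / (z - a) ^ n) a (g a)
  have hGa : G =ᶠ[𝓝 a] g := by
    filter_upwards [hfg] with z hz
    rcases eq_or_ne z a with rfl | hza
    · simp [G]
    · have : (z - a) ^ n ≠ 0 := pow_ne_zero _ (sub_ne_zero.2 hza)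
      simp [G, hza, hz, this]
  have hGz : ∀ z, f z = (z - a) ^ n * G z := by
    intro z
    rcases eq_or_ne z a with rfl | hza
    · rw [hGa.eq_of_nhds]
      simpa using hfg.eq_of_nhds
    · have : (z - a) ^ n ≠ 0 := pow_ne_zero _ (sub_ne_zero.2 hza)
      simp [G, hza]
      field_simp
  refine ⟨G, fun z ↦ ?_, by simpa [G] using hg0, hGz⟩
  rcases eq_or_ne z a with rfl | hza
  · exact hGa.differentiableAt_iff.2 hga.differentiableAt
  · have : G =ᶠ[𝓝 z] fun z ↦ f z / (z - a) ^ n := by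
      filter_upwards [eventually_ne_nhds hza] with w hw
      simp [G, hw]
    refine this.differentiableAt_iff.2 ((hf z).div (by fun_prop) ?_)
    exact pow_ne_zero _ (sub_ne_zero.2 hza)

/-- Finitely many zeros of an entire function can be divided out. -/
lemma exists_differentiable_eq_prod_pow_mul {f : ℂ → ℂ} (hf : Differentiable ℂ f)
    (hord : ∀ a, analyticOrderAt f a ≠ ⊤) (S : Finset ℂ) :
    ∃ g : ℂ → ℂ, Differentiable ℂ g ∧ (∀ a ∈ S, g a ≠ 0) ∧
      ∀ z, f z = (∏ a ∈ S, (z - a) ^ analyticOrderNatAt f a) * g z := by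
  induction S using Finset.induction_on with
  | empty => exact ⟨f, hf, by simp, by simp⟩
  | insert b S hb ih =>
    obtain ⟨g, hg, hgS, hfg⟩ := ih
    let P : ℂ → ℂ := fun z ↦ ∏ a ∈ S, (z - a) ^ analyticOrderNatAt f a
    have hP : Differentiable ℂ P := by fun_prop
    have hPb : P b ≠ 0 := Finset.prod_ne_zero_iff.2 fun a ha ↦
      pow_ne_zero _ (sub_ne_zero.2 fun h ↦ hb (h ▸ ha))
    have hfP : f = P * g := funext hfg
    have hob : analyticOrderAt f b = analyticOrderAt g b := by
      have := analyticOrderAt_smul (hP.analyticAt b) (hg.analyticAt b)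
      rw [smul_eq_mul, ← hfP, analyticOrderAt_eq_zero.2 (Or.inr hPb), zero_add] at this
      exact this
    obtain ⟨h, hh, hhb, hgh⟩ := exists_differentiable_eq_pow_mul hg (hob ▸ hord b)
    refine ⟨h, hh, ?_, fun z ↦ ?_⟩
    · intro a ha
      rcases Finset.mem_insert.1 ha with rfl | ha
      · exact hhb
      · have := hgS a ha
        rw [hgh] at this
        exact right_ne_zero_of_mul this
    · rw [Finset.prod_insert hb, hfg, hgh]
      simp only [analyticOrderNatAt, hob]
      ring

/-- Partial-fraction approximation of the difference of the logarithmic derivative of an entire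
function at `1` and `0` by the zeros in a disc. -/
lemma norm_logDeriv_one_sub_logDeriv_zero_sub_sum_le {f : ℂ → ℂ} {R A : ℝ}
    (hf : Differentiable ℂ f) (hR : 8 ≤ R) (hA : 0 < A) (h0 : f 0 = 1) (h1 : f 1 ≠ 0)
    (hb : ∀ z, ‖z‖ ≤ 2 * R → ‖f z‖ ≤ Real.exp A) (S : Finset ℂ)
    (hS : ∀ a, a ∈ S ↔ ‖a‖ ≤ R ∧ f a = 0) :
    ‖logDeriv f 1 - logDeriv f 0 - ∑ a ∈ S, (analyticOrderNatAt f a : ℂ) / (a * (1 - a))‖ ≤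
      64 * A / R ^ 2 := by
  have hord : ∀ a, analyticOrderAt f a ≠ ⊤ := fun a ↦
    AnalyticOnNhd.analyticOrderAt_ne_top_of_isPreconnected (U := Set.univ) (x := 0)
      (fun z _ ↦ hf.analyticAt z) isPreconnected_univ (Set.mem_univ _) (Set.mem_univ _)
      (by rw [analyticOrderAt_eq_zero.2 (Or.inr (by simp [h0]))]; simp)
  obtain ⟨g, hg, hgS, hfg⟩ := exists_differentiable_eq_prod_pow_mul hf hord S
  have ha0 : ∀ a ∈ S, a ≠ 0 := by
    rintro a ha rfl
    simpa [h0] using ((hS 0).1 ha).2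
  have ha1 : ∀ a ∈ S, a ≠ 1 := by
    rintro a ha rfl
    exact h1 ((hS 1).1 ha).2
  let P : ℂ → ℂ := fun z ↦ ∏ a ∈ S, (z - a) ^ analyticOrderNatAt f a
  have hP : Differentiable ℂ P := by fun_prop
  have hPne : ∀ z, (∀ a ∈ S, a ≠ z) → P z ≠ 0 := fun z hz ↦
    Finset.prod_ne_zero_iff.2 fun a ha ↦ pow_ne_zero _ (sub_ne_zero.2 (hz a ha).symm)
  have hP0 : P 0 ≠ 0 := hPne 0 ha0
  have hP1 : P 1 ≠ 0 := hPne 1 ha1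
  have hfP : f = fun z ↦ P z * g z := funext hfg
  have hgne : ∀ z ∈ ball (0 : ℂ) R, g z ≠ 0 := by
    intro z hz hgz
    have hzS : z ∈ S := (hS z).2 ⟨(mem_ball_zero_iff.1 hz).le, by rw [hfg, hgz, mul_zero]⟩
    exact hgS z hzS hgz
  have hlogP : ∀ z, (∀ a ∈ S, a ≠ z) →
      logDeriv P z = ∑ a ∈ S, (analyticOrderNatAt f a : ℂ) * (1 / (z - a)) := by
    intro z hz
    refine (logDeriv_prod (f := fun a z ↦ (z - a) ^ analyticOrderNatAt f a) (x := z)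
      (fun a ha ↦ pow_ne_zero _ (sub_ne_zero.2 (hz a ha).symm)) (fun a _ ↦ by fun_prop)).trans ?_
    refine Finset.sum_congr rfl fun a _ ↦ ?_
    rw [logDeriv_fun_pow (f := fun z ↦ z - a) (by fun_prop), logDeriv_apply]
    simp
  have hlogf : ∀ z, (∀ a ∈ S, a ≠ z) → g z ≠ 0 → logDeriv f z = logDeriv P z + logDeriv g z := by
    intro z hz hgz
    conv_lhs => rw [hfP]
    exact logDeriv_mul z (hPne z hz) hgz (hP z) (hg z)
  have hg0 : g 0 ≠ 0 := hgne 0 (by simp; linarith)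
  have hg1 : g 1 ≠ 0 := hgne 1 (by simp; linarith)
  have hPg : P 0 * g 0 = 1 := by rw [← h0, hfg 0]
  let h : ℂ → ℂ := fun z ↦ g z * P 0
  have hlogh : ∀ z, logDeriv h z = logDeriv g z := fun z ↦ logDeriv_mul_const z _ hP0
  have hhb : ∀ z ∈ closedBall (0 : ℂ) (2 * R), ‖h z‖ ≤ Real.exp A := by
    intro z hz
    refine Complex.norm_le_of_forall_mem_frontier_norm_le (U := ball (0 : ℂ) (2 * R))
      isBounded_ball (hg.mul_const (P 0)).diffContOnCl (fun w hw ↦ ?_)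
      (by rwa [closure_ball _ (by linarith)])
    have hw' : ‖w‖ = 2 * R := by simpa using frontier_ball_subset_sphere hw
    have hPw : ‖P 0‖ ≤ ‖P w‖ := by
      simp only [P, norm_prod, norm_pow]
      refine Finset.prod_le_prod (fun _ _ ↦ by positivity) fun a ha ↦ ?_
      gcongr
      have := norm_sub_norm_le w a
      have := ((hS a).1 ha).1
      simp only [zero_sub, norm_neg]
      linarith
    calc ‖g w * P 0‖ = ‖P 0‖ * ‖g w‖ := by rw [norm_mul, mul_comm]
      _ ≤ ‖P w‖ * ‖g w‖ := by gcongr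
      _ = ‖f w‖ := by rw [← norm_mul, hfg]
      _ ≤ Real.exp A := hb w hw'.le
  have key := norm_logDeriv_one_sub_logDeriv_zero_le (g := h) (hg.mul_const _) hR hA
    (by rw [← hPg]; exact mul_comm _ _) (fun z hz ↦ mul_ne_zero (hgne z hz) hP0)
    (fun z hz ↦ hhb z (ball_subset_closedBall.trans (closedBall_subset_closedBall
      (by linarith)) hz))
  rw [hlogh, hlogh] at key
  rw [hlogf 1 ha1 hg1, hlogf 0 ha0 hg0, hlogP 1 ha1, hlogP 0 ha0]
  convert key using 2
  have : ∑ a ∈ S, (analyticOrderNatAt f a : ℂ) / (a * (1 - a)) =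
      ∑ a ∈ S, (analyticOrderNatAt f a : ℂ) * (1 / (1 - a)) -
      ∑ a ∈ S, (analyticOrderNatAt f a : ℂ) * (1 / (0 - a)) := by
    rw [← Finset.sum_sub_distrib]
    refine Finset.sum_congr rfl fun a ha ↦ ?_
    have h3 := ha0 a ha
    have h4 : 1 - a ≠ 0 := sub_ne_zero.2 (ha1 a ha).symm
    rw [zero_sub]
    field_simp
    ring
  rw [this]
  ring

/-- The completed zeta function with poles removed is bounded on the strip `0 ≤ Re s ≤ 4`. -/
lemma exists_norm_completedRiemannZeta₀_le_of_re_mem :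
    ∃ C : ℝ, ∀ s : ℂ, 0 ≤ s.re → s.re ≤ 4 → ‖completedRiemannZeta₀ s‖ ≤ C := by
  let P := HurwitzZeta.hurwitzEvenFEPair 0
  have hconv : ∀ w : ℂ, MeasureTheory.IntegrableOn
      (fun t : ℝ ↦ (t : ℂ) ^ (w - 1) • P.f_modif t) (Set.Ioi 0) := fun w ↦
    (P.isStrongFEPair_toStrongFEPair.hasMellin w).1
  refine ⟨(∫ t in Set.Ioi (0 : ℝ), (‖(t : ℂ) ^ ((0 : ℂ) - 1) • P.f_modif t‖ +
    ‖(t : ℂ) ^ ((2 : ℂ) - 1) • P.f_modif t‖)) / 2, fun s h0 h4 ↦ ?_⟩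
  have hs : completedRiemannZeta₀ s = P.Λ₀ (s / 2) / 2 := rfl
  rw [hs, norm_div, Complex.norm_ofNat]
  gcongr
  refine MeasureTheory.norm_integral_le_of_norm_le ((hconv 0).norm.add (hconv 2).norm) ?_
  refine (MeasureTheory.ae_restrict_iff' measurableSet_Ioi).2 (.of_forall fun t ht ↦ ?_)
  have ht : 0 < t := ht
  simp only [norm_smul, Complex.norm_cpow_eq_rpow_re_of_pos ht]
  rw [← add_mul]
  gcongr
  have hre : (s / 2).re = s.re / 2 := by simp
  rcases le_total 1 t with h | h
  · refine le_add_of_nonneg_of_le (by positivity) (Real.rpow_le_rpow_of_exponent_le h ?_)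
    simp [hre]
    linarith
  · refine le_add_of_le_of_nonneg (Real.rpow_le_rpow_of_exponent_ge ht h ?_) (by positivity)
    simp [hre]
    linarith

lemma Complex.norm_Gamma_le_Gamma_re {s : ℂ} (hs : 0 < s.re) :
    ‖Complex.Gamma s‖ ≤ Real.Gamma s.re := by
  rw [Complex.Gamma_eq_integral hs, Real.Gamma_eq_integral hs, Complex.GammaIntegral]
  refine MeasureTheory.norm_integral_le_of_norm_le (Real.GammaIntegral_convergent hs) ?_
  refine (MeasureTheory.ae_restrict_iff' measurableSet_Ioi).2 (.of_forall fun t ht ↦ ?_)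
  have ht : 0 < t := ht
  rw [norm_mul, Complex.norm_cpow_eq_rpow_re_of_pos ht, Complex.norm_real, Real.norm_eq_abs,
    abs_of_pos (Real.exp_pos _)]
  simp

lemma Real.Gamma_le_add_one_rpow {x : ℝ} (hx : 2 ≤ x) :
    Real.Gamma x ≤ (x + 1) ^ (x + 1) := by
  have h1 : x ≤ ⌈x⌉₊ := Nat.le_ceil x
  have h2 : (⌈x⌉₊ : ℝ) < x + 1 := Nat.ceil_lt_add_one (by linarith)
  calc Real.Gamma x ≤ Real.Gamma (⌈x⌉₊ + 1) :=
        Real.Gamma_strictMonoOn_Ici.monotoneOn hx (Set.mem_Ici.2 (by linarith)) (by linarith)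
    _ = (⌈x⌉₊.factorial : ℝ) := Real.Gamma_nat_eq_factorial _
    _ ≤ (⌈x⌉₊ : ℝ) ^ ⌈x⌉₊ := mod_cast Nat.factorial_le_pow _
    _ ≤ (x + 1) ^ ⌈x⌉₊ := by gcongr
    _ = (x + 1) ^ (⌈x⌉₊ : ℝ) := (Real.rpow_natCast _ _).symm
    _ ≤ (x + 1) ^ (x + 1) := Real.rpow_le_rpow_of_exponent_le (by linarith) h2.le

lemma norm_riemannZeta_le_of_two_le_re {s : ℂ} (hs : 2 ≤ s.re) :
    ‖riemannZeta s‖ ≤ ∑' n : ℕ, 1 / (n : ℝ) ^ 2 := by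
  rw [zeta_eq_tsum_one_div_nat_cpow (by linarith)]
  refine tsum_of_norm_bounded (Real.summable_one_div_nat_pow.2 one_lt_two).hasSum fun n ↦ ?_
  rcases Nat.eq_zero_or_pos n with rfl | hn
  · rw [Nat.cast_zero, Complex.zero_cpow (fun h ↦ by simp [h] at hs; linarith)]
    simp
  · rw [norm_div, norm_one, Complex.norm_natCast_cpow_of_pos hn, ← Real.rpow_natCast]
    have : (1 : ℝ) ≤ n := mod_cast hn
    gcongr
    exact mod_cast hs

/-- The completed zeta function with poles removed has order at most one. -/
lemma exists_norm_completedRiemannZeta₀_le :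
    ∃ C : ℝ, 0 ≤ C ∧ ∀ s : ℂ, ‖completedRiemannZeta₀ s‖ ≤ C * (‖s‖ + 3) ^ (‖s‖ + 3) := by
  obtain ⟨C₁, hC₁⟩ := exists_norm_completedRiemannZeta₀_le_of_re_mem
  have hC₁0 : 0 ≤ C₁ := (norm_nonneg _).trans (hC₁ 0 le_rfl (by simp))
  set C₂ : ℝ := ∑' n : ℕ, 1 / (n : ℝ) ^ 2
  have hC₂0 : 0 ≤ C₂ := tsum_nonneg fun n ↦ by positivity
  have right : ∀ s : ℂ, 0 ≤ s.re →
      ‖completedRiemannZeta₀ s‖ ≤ (C₁ + C₂ + 2) * (‖s‖ + 2) ^ (‖s‖ + 2) := by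
    intro s hs
    have hone : (1 : ℝ) ≤ (‖s‖ + 2) ^ (‖s‖ + 2) :=
      Real.one_le_rpow (by linarith [norm_nonneg s]) (by positivity)
    rcases le_total s.re 4 with h4 | h4
    · nlinarith [hC₁ s hs h4]
    · have hsre : s.re ≤ ‖s‖ := Complex.re_le_norm s
      have hs0 : s ≠ 0 := fun h ↦ by simp [h] at h4; linarith
      have hG : Complex.Gammaℝ s ≠ 0 := Complex.Gammaℝ_ne_zero_of_re_pos (by linarith)
      have hΛ : completedRiemannZeta₀ s =
          riemannZeta s * Complex.Gammaℝ s + 1 / s + 1 / (1 - s) := by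
        rw [riemannZeta_def_of_ne_zero hs0, div_mul_cancel₀ _ hG, completedRiemannZeta_eq]
        ring
      have hGle : ‖Complex.Gammaℝ s‖ ≤ (‖s‖ + 2) ^ (‖s‖ + 2) := by
        have hre : (s / 2).re = s.re / 2 := by simp
        have hΓ : ‖Complex.Gamma (s / 2)‖ ≤ Real.Gamma (s.re / 2) :=
          hre ▸ Complex.norm_Gamma_le_Gamma_re (s := s / 2) (by rw [hre]; linarith)
        have hπ : ‖(π : ℂ) ^ (-s / 2)‖ ≤ 1 := by
          rw [Complex.norm_cpow_eq_rpow_re_of_pos Real.pi_pos]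
          refine Real.rpow_le_one_of_one_le_of_nonpos (by linarith [Real.pi_gt_three]) ?_
          simp
          linarith
        calc ‖Complex.Gammaℝ s‖ = ‖(π : ℂ) ^ (-s / 2)‖ * ‖Complex.Gamma (s / 2)‖ := by
              rw [Complex.Gammaℝ_def, norm_mul]
          _ ≤ 1 * (s.re / 2 + 1) ^ (s.re / 2 + 1) := by
              gcongr
              exact hΓ.trans (Real.Gamma_le_add_one_rpow (by linarith))
          _ ≤ (‖s‖ + 2) ^ (s.re / 2 + 1) := by
              rw [one_mul]
              gcongr <;> linarith
          _ ≤ (‖s‖ + 2) ^ (‖s‖ + 2) :=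
              Real.rpow_le_rpow_of_exponent_le (by linarith) (by linarith)
      have h1 : ‖1 / s‖ ≤ 1 := by
        rw [norm_div, norm_one]
        exact div_le_one_of_le₀ (by linarith) (norm_nonneg _)
      have h2 : ‖1 / (1 - s)‖ ≤ 1 := by
        rw [norm_div, norm_one]
        refine div_le_one_of_le₀ ?_ (norm_nonneg _)
        have := norm_sub_norm_le s 1
        rw [norm_sub_rev, norm_one] at this
        linarith
      calc ‖completedRiemannZeta₀ s‖ ≤ ‖riemannZeta s‖ * ‖Complex.Gammaℝ s‖ + 1 + 1 := by
            rw [hΛ, ← norm_mul]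
            exact (norm_add_le _ _).trans (add_le_add ((norm_add_le _ _).trans
              (add_le_add le_rfl h1)) h2)
        _ ≤ C₂ * (‖s‖ + 2) ^ (‖s‖ + 2) + 1 + 1 := by
            gcongr
            exact norm_riemannZeta_le_of_two_le_re (by linarith)
        _ ≤ _ := by nlinarith
  have mono : ∀ {x y : ℝ}, 0 ≤ x → x + 2 ≤ y + 3 → (x + 2) ^ (x + 2) ≤ (y + 3) ^ (y + 3) := by
    intro x y hx hxy
    exact (Real.rpow_le_rpow (by linarith) hxy (by linarith)).trans
      (Real.rpow_le_rpow_of_exponent_le (by linarith) hxy)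
  refine ⟨C₁ + C₂ + 2, by positivity, fun s ↦ ?_⟩
  rcases le_total 0 s.re with hs | hs
  · refine (right s hs).trans ?_
    gcongr ?_ * ?_
    exact mono (norm_nonneg _) (by linarith)
  · rw [← completedRiemannZeta₀_one_sub]
    refine (right (1 - s) (by simp; linarith)).trans ?_
    gcongr ?_ * ?_
    refine mono (norm_nonneg _) ?_
    have := norm_sub_le 1 s
    rw [norm_one] at this
    linarith

/-- The entire function `s (s - 1) Λ(s)`, that is, twice the Riemann `ξ`-function. -/
noncomputable def entireXi (s : ℂ) : ℂ := s * (s - 1) * completedRiemannZeta₀ s + 1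

lemma differentiable_entireXi : Differentiable ℂ entireXi :=
  ((differentiable_id.mul (differentiable_id.sub_const 1)).mul
    differentiable_completedZeta₀).add_const 1

lemma entireXi_zero : entireXi 0 = 1 := by simp [entireXi]

lemma entireXi_one : entireXi 1 = 1 := by simp [entireXi]

lemma logDeriv_entireXi_one_sub_logDeriv_entireXi_zero :
    logDeriv entireXi 1 - logDeriv entireXi 0 =
      ((2 + Real.eulerMascheroniConstant - Real.log (4 * π) : ℝ) : ℂ) := by
  have hd : ∀ s, HasDerivAt entireXi
      ((2 * s - 1) * completedRiemannZeta₀ s +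
        s * (s - 1) * deriv completedRiemannZeta₀ s) s := fun s ↦ by
    refine ((((hasDerivAt_id s).mul ((hasDerivAt_id s).sub_const 1)).mul
      (differentiable_completedZeta₀ s).hasDerivAt).add_const 1).congr_deriv ?_
    simp only [id_eq, Pi.mul_apply]
    ring
  rw [logDeriv_apply, logDeriv_apply, (hd 1).deriv, (hd 0).deriv, entireXi_zero, entireXi_one,
    completedRiemannZeta₀_zero, completedRiemannZeta₀_one]
  have : Complex.log (4 * (π : ℂ)) = ((Real.log (4 * π) : ℝ) : ℂ) := by
    rw [Complex.ofReal_log (by positivity)]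
    simp
  push_cast at this ⊢
  rw [this]
  ring

lemma entireXi_eq {s : ℂ} (h0 : s ≠ 0) (h1 : s ≠ 1) :
    entireXi s = s * (s - 1) * completedRiemannZeta s := by
  have : 1 - s ≠ 0 := sub_ne_zero.2 h1.symm
  rw [entireXi, completedRiemannZeta_eq]
  field_simp
  ring

lemma entireXi_eq_zero_iff {s : ℂ} :
    entireXi s = 0 ↔ riemannZeta s = 0 ∧ 0 < s.re ∧ s.re < 1 := by
  have key : ∀ w : ℂ, 1 ≤ w.re → completedRiemannZeta w ≠ 0 := fun w hw h ↦ by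
    have hw0 : w ≠ 0 := fun h ↦ by simp [h] at hw; linarith
    exact riemannZeta_ne_zero_of_one_le_re hw (by rw [riemannZeta_def_of_ne_zero hw0, h, zero_div])
  constructor
  · intro h
    have h0 : s ≠ 0 := fun hs ↦ by simp [hs, entireXi_zero] at h
    have h1 : s ≠ 1 := fun hs ↦ by simp [hs, entireXi_one] at h
    rw [entireXi_eq h0 h1] at h
    have hΛ : completedRiemannZeta s = 0 := by
      simpa [h0, sub_ne_zero.2 h1] using h
    refine ⟨by rw [riemannZeta_def_of_ne_zero h0, hΛ, zero_div], ?_, ?_⟩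
    · by_contra! hre
      refine key (1 - s) (by simp; linarith) ?_
      rw [completedRiemannZeta_one_sub, hΛ]
    · by_contra! hre
      exact key s hre hΛ
  · rintro ⟨hζ, hpos, hlt⟩
    have h0 : s ≠ 0 := fun hs ↦ by simp [hs] at hpos
    have h1 : s ≠ 1 := fun hs ↦ by simp [hs] at hlt
    rw [riemannZeta_def_of_ne_zero h0,
      div_eq_zero_iff, or_iff_left (Complex.Gammaℝ_ne_zero_of_re_pos hpos)] at hζ
    rw [entireXi_eq h0 h1, hζ, mul_zero]

lemma analyticOrderAt_entireXi_ne_top (a : ℂ) : analyticOrderAt entireXi a ≠ ⊤ :=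
  AnalyticOnNhd.analyticOrderAt_ne_top_of_isPreconnected (U := Set.univ) (x := 0)
    (fun z _ ↦ differentiable_entireXi.analyticAt z) isPreconnected_univ (Set.mem_univ _)
    (Set.mem_univ _)
    (by rw [analyticOrderAt_eq_zero.2 (Or.inr (by simp [entireXi_zero]))]; simp)

lemma zetaZeroMultiplicity_eq_analyticOrderNatAt {ρ : ℂ} (h0 : 0 < ρ.re) (h1 : ρ.re < 1) :
    zetaZeroMultiplicity ρ = analyticOrderNatAt entireXi ρ := by
  have hρ0 : ρ ≠ 0 := fun hs ↦ by simp [hs] at h0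
  have hρ1 : ρ ≠ 1 := fun hs ↦ by simp [hs] at h1
  let u : ℂ → ℂ := fun s ↦ (s * (s - 1))⁻¹ * (Complex.Gammaℝ s)⁻¹
  have hu0 : u ρ ≠ 0 := mul_ne_zero (inv_ne_zero (mul_ne_zero hρ0 (sub_ne_zero.2 hρ1)))
    (inv_ne_zero (Complex.Gammaℝ_ne_zero_of_re_pos h0))
  have hu : AnalyticAt ℂ u ρ := by
    refine AnalyticAt.mul (AnalyticAt.inv (by fun_prop) ?_)
      (Complex.differentiable_Gammaℝ_inv.analyticAt ρ)
    exact mul_ne_zero hρ0 (sub_ne_zero.2 hρ1)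
  have heq : riemannZeta =ᶠ[𝓝 ρ] u • entireXi := by
    filter_upwards [eventually_ne_nhds hρ0, eventually_ne_nhds hρ1] with s hs0 hs1
    have : s - 1 ≠ 0 := sub_ne_zero.2 hs1
    simp only [u, Pi.smul_apply', smul_eq_mul]
    rw [entireXi_eq hs0 hs1, riemannZeta_def_of_ne_zero hs0]
    field_simp
  have hord : analyticOrderAt riemannZeta ρ = analyticOrderAt entireXi ρ := by
    rw [analyticOrderAt_congr heq,
      analyticOrderAt_smul hu (differentiable_entireXi.analyticAt ρ),
      analyticOrderAt_eq_zero.2 (Or.inr hu0), zero_add]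
  have hana : AnalyticAt ℂ riemannZeta ρ := analyticOn_riemannZeta ρ hρ1
  have hnat := Nat.cast_analyticOrderNatAt (analyticOrderAt_entireXi_ne_top ρ)
  rw [← hord, eq_comm, analyticOrderAt_eq_nat_iff_iteratedDeriv_eq_zero hana] at hnat
  refine le_antisymm (Nat.sInf_le hnat.2) (le_csInf ⟨_, hnat.2⟩ fun n hn ↦ ?_)
  by_contra! hlt
  exact hn (hnat.1 n hlt)

lemma exists_norm_entireXi_le :
    ∃ C : ℝ, 0 < C ∧ ∀ r : ℝ, 0 ≤ r → ∀ s : ℂ, ‖s‖ ≤ r →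
      ‖entireXi s‖ ≤ Real.exp (C + (r + 5) * Real.log (r + 3)) := by
  obtain ⟨C, hC0, hC⟩ := exists_norm_completedRiemannZeta₀_le
  refine ⟨C + 1, by positivity, fun r hr s hs ↦ ?_⟩
  have hmono : (‖s‖ + 3) ^ (‖s‖ + 3) ≤ (r + 3) ^ (r + 3) :=
    (Real.rpow_le_rpow (by positivity) (by linarith) (by positivity)).trans
      (Real.rpow_le_rpow_of_exponent_le (by linarith) (by linarith))
  have hone : (1 : ℝ) ≤ (r + 3) ^ (r + 3) := Real.one_le_rpow (by linarith) (by linarith)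
  have h1 : ‖s - 1‖ ≤ r + 1 := (norm_sub_le s 1).trans (by rw [norm_one]; linarith)
  have hsplit : (r + 3) ^ (r + 5) = (r + 3) ^ (r + 3) * (r + 3) ^ 2 := by
    rw [← Real.rpow_natCast, ← Real.rpow_add (by positivity)]
    congr 1
    push_cast
    ring
  calc ‖entireXi s‖ ≤ ‖s‖ * ‖s - 1‖ * ‖completedRiemannZeta₀ s‖ + 1 := by
        rw [entireXi, ← norm_mul, ← norm_mul]
        exact (norm_add_le _ _).trans (by rw [norm_one])
    _ ≤ (r + 3) * (r + 3) * (C * (r + 3) ^ (r + 3)) + 1 * (r + 3) ^ (r + 3) * (r + 3) ^ 2 := by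
        have h3 : (1 : ℝ) ≤ (r + 3) ^ 2 := by nlinarith
        gcongr
        · linarith
        · linarith
        · exact (hC s).trans (by gcongr)
        · nlinarith
    _ = (C + 1) * (r + 3) ^ (r + 5) := by rw [hsplit]; ring
    _ ≤ Real.exp (C + 1) * (r + 3) ^ (r + 5) := by
        gcongr
        linarith [Real.add_one_le_exp (C + 1)]
    _ = Real.exp (C + 1 + (r + 5) * Real.log (r + 3)) := by
        rw [Real.rpow_def_of_pos (by linarith), ← Real.exp_add, mul_comm (Real.log _)]

lemma tendsto_const_add_mul_log_div_sq (C : ℝ) :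
    Tendsto (fun r : ℝ ↦ (C + (2 * r + 5) * Real.log (2 * r + 3)) / r ^ 2) atTop (𝓝 0) := by
  have hlin : Tendsto (fun r : ℝ ↦ 2 * r + 3) atTop atTop :=
    tendsto_atTop_add_const_right _ _ (tendsto_id.const_mul_atTop two_pos)
  have hlog : Tendsto (fun r : ℝ ↦ Real.log (2 * r + 3) / (2 * r + 3)) atTop (𝓝 0) :=
    Real.isLittleO_log_id_atTop.tendsto_div_nhds_zero.comp hlin
  have hinv : Tendsto (fun r : ℝ ↦ r⁻¹) atTop (𝓝 0) := tendsto_inv_atTop_zero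
  have h : Tendsto (fun r : ℝ ↦ C * r⁻¹ ^ 2 +
      (2 + 5 * r⁻¹) * (2 + 3 * r⁻¹) * (Real.log (2 * r + 3) / (2 * r + 3))) atTop (𝓝 0) := by
    convert ((hinv.pow 2).const_mul C).add
      ((((hinv.const_mul 5).const_add 2).mul ((hinv.const_mul 3).const_add 2)).mul hlog) using 2
    simp
  refine h.congr' ?_
  filter_upwards [eventually_gt_atTop 0] with r hr
  field_simp

/-- The family `(m_ρ / (ρ(1-ρ)))_ρ` indexed by the nontrivial zeros `ρ` of the Riemann
zeta function (with multiplicities `m_ρ`) is summable, with sum `2 + γ - log (4π)`. -/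
theorem tsum_zeta_zeros_inv_rho_one_sub_rho :
    Summable (fun ρ : {ρ : ℂ // riemannZeta ρ = 0 ∧ 0 < ρ.re ∧ ρ.re < 1} =>
      (zetaZeroMultiplicity ρ.1 : ℂ) / (ρ.1 * (1 - ρ.1))) ∧
    ∑' ρ : {ρ : ℂ // riemannZeta ρ = 0 ∧ 0 < ρ.re ∧ ρ.re < 1},
        (zetaZeroMultiplicity ρ.1 : ℂ) / (ρ.1 * (1 - ρ.1)) =
      ((2 + Real.eulerMascheroniConstant - Real.log (4 * π) : ℝ) : ℂ) := by
  set c : ℝ := 2 + Real.eulerMascheroniConstant - Real.log (4 * π)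
  let T := {ρ : ℂ // riemannZeta ρ = 0 ∧ 0 < ρ.re ∧ ρ.re < 1}
  let F : T → ℂ := fun ρ ↦ (zetaZeroMultiplicity ρ.1 : ℂ) / (ρ.1 * (1 - ρ.1))
  change Summable F ∧ ∑' ρ, F ρ = (c : ℂ)
  have hfin : ∀ n : ℕ, {ρ : T | ‖ρ.1‖ ≤ n}.Finite := fun n ↦ by
    refine Set.Finite.of_finite_image (f := Subtype.val) ?_ Subtype.val_injective.injOn
    refine (isCompact_closedBall (0 : ℂ) n).inter_riemannZetaZeros_finite.subset ?_
    rintro _ ⟨ρ, hρ, rfl⟩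
    exact ⟨mem_closedBall_zero_iff.2 hρ, ρ.2.1⟩
  let S : ℕ → Finset T := fun n ↦ (hfin n).toFinset
  have hmemS : ∀ n ρ, ρ ∈ S n ↔ ‖ρ.1‖ ≤ n := fun n ρ ↦ by simp [S]
  have hS : Tendsto S atTop atTop := by
    refine tendsto_atTop_finset_of_monotone (fun m n hmn ρ hρ ↦ ?_) fun ρ ↦ ?_
    · rw [hmemS] at hρ ⊢
      exact hρ.trans (mod_cast hmn)
    · obtain ⟨n, hn⟩ := exists_nat_ge ‖ρ.1‖
      exact ⟨n, (hmemS n ρ).2 hn⟩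
  have hlim : Tendsto (fun n ↦ ∑ ρ ∈ S n, F ρ) atTop (𝓝 (c : ℂ)) := by
    obtain ⟨C, hC0, hC⟩ := exists_norm_entireXi_le
    have hA := ((tendsto_const_add_mul_log_div_sq C).const_mul 64).comp
      (tendsto_natCast_atTop_atTop (R := ℝ))
    rw [mul_zero] at hA
    rw [tendsto_iff_norm_sub_tendsto_zero]
    refine squeeze_zero' (.of_forall fun _ ↦ norm_nonneg _) ?_ hA
    filter_upwards [eventually_ge_atTop 8] with n hn
    have hn' : (8 : ℝ) ≤ n := mod_cast hn
    have hApos : 0 < C + (2 * (n : ℝ) + 5) * Real.log (2 * n + 3) :=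
      add_pos_of_pos_of_nonneg hC0 (mul_nonneg (by positivity) (Real.log_nonneg (by linarith)))
    have hmem : ∀ a, a ∈ (S n).map (Function.Embedding.subtype _) ↔
        ‖a‖ ≤ (n : ℝ) ∧ entireXi a = 0 := fun a ↦ by
      rw [Finset.mem_map, entireXi_eq_zero_iff]
      constructor
      · rintro ⟨ρ, hρ, rfl⟩
        exact ⟨(hmemS n ρ).1 hρ, ρ.2⟩
      · rintro ⟨ha, ha'⟩
        exact ⟨⟨a, ha'⟩, (hmemS n _).2 ha, rfl⟩
    have key := norm_logDeriv_one_sub_logDeriv_zero_sub_sum_le differentiable_entireXi hn' hApos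
      entireXi_zero (by simp [entireXi_one]) (hC (2 * n) (by positivity)) _ hmem
    rw [logDeriv_entireXi_one_sub_logDeriv_entireXi_zero, Finset.sum_map, norm_sub_rev] at key
    have hsum : ∑ ρ ∈ S n, F ρ = ∑ ρ ∈ S n,
        (analyticOrderNatAt entireXi (Function.Embedding.subtype _ ρ) : ℂ) /
          (Function.Embedding.subtype _ ρ * (1 - Function.Embedding.subtype _ ρ)) :=
      Finset.sum_congr rfl fun ρ _ ↦ by
        simp only [F, zetaZeroMultiplicity_eq_analyticOrderNatAt ρ.2.2.1 ρ.2.2.2]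
        rfl
    rw [hsum]
    refine key.trans_eq ?_
    simp [mul_div_assoc]
  have hre : ∀ ρ : T, (ρ.1 * (1 - ρ.1)).re = ρ.1.re * (1 - ρ.1.re) + ρ.1.im ^ 2 := fun ρ ↦ by
    simp
    ring
  have hrepos : ∀ ρ : T, 0 < (ρ.1 * (1 - ρ.1)).re := fun ρ ↦ by
    rw [hre]
    have := mul_pos ρ.2.2.1 (sub_pos.2 ρ.2.2.2)
    positivity
  have hFre : ∀ ρ : T, (F ρ).re =
      zetaZeroMultiplicity ρ.1 * ((ρ.1 * (1 - ρ.1)).re / ‖ρ.1 * (1 - ρ.1)‖ ^ 2) := fun ρ ↦ by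
    simp only [F, div_eq_mul_inv]
    rw [← Complex.ofReal_natCast, Complex.re_ofReal_mul, Complex.inv_re, Complex.sq_norm]
    rfl
  have hFnonneg : ∀ ρ, 0 ≤ (F ρ).re := fun ρ ↦ by
    rw [hFre]
    have := hrepos ρ
    positivity
  have hsumre : Summable fun ρ ↦ (F ρ).re := by
    refine summable_of_sum_le (c := c) hFnonneg fun u ↦ ?_
    refine ge_of_tendsto ((Complex.continuous_re.tendsto _).comp hlim) ?_
    filter_upwards [hS.eventually_ge_atTop u] with n hn
    simp only [Function.comp_apply, Complex.re_sum]
    exact Finset.sum_le_sum_of_subset_of_nonneg hn fun ρ _ _ ↦ hFnonneg ρ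
  have hsum : Summable F := by
    refine (hsumre.mul_left 2).of_norm_bounded_eventually ?_
    refine (hfin 2).subset fun ρ hρ ↦ by_contra fun hlarge ↦ hρ ?_
    change ¬ ‖ρ.1‖ ≤ (2 : ℕ) at hlarge
    rw [not_le, Nat.cast_ofNat] at hlarge
    change ‖F ρ‖ ≤ 2 * (F ρ).re
    have him : 1 ≤ |ρ.1.im| := by
      have := Complex.norm_le_abs_re_add_abs_im ρ.1
      rw [abs_of_pos ρ.2.2.1] at this
      linarith [ρ.2.2.2]
    have hw := hrepos ρ
    have hnorm : ‖ρ.1 * (1 - ρ.1)‖ ≤ 2 * (ρ.1 * (1 - ρ.1)).re := by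
      refine (Complex.norm_le_abs_re_add_abs_im _).trans ?_
      rw [abs_of_pos hw, two_mul]
      gcongr
      have h1 : (ρ.1 * (1 - ρ.1)).im = ρ.1.im * (1 - 2 * ρ.1.re) := by
        simp
        ring
      have h2 : |1 - 2 * ρ.1.re| ≤ 1 := abs_le.2 ⟨by linarith [ρ.2.2.2], by linarith [ρ.2.2.1]⟩
      rw [h1, abs_mul, hre, ← sq_abs ρ.1.im]
      nlinarith [mul_pos ρ.2.2.1 (sub_pos.2 ρ.2.2.2), abs_nonneg (1 - 2 * ρ.1.re)]
    have hpos : 0 < ‖ρ.1 * (1 - ρ.1)‖ := norm_pos_iff.2 fun h ↦ by simp [h] at hw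
    rw [hFre, norm_div, Complex.norm_natCast, mul_left_comm, div_eq_mul_inv]
    gcongr
    rw [inv_eq_one_div, mul_div_assoc', div_le_div_iff₀ hpos (by positivity)]
    nlinarith
  exact ⟨hsum, tendsto_nhds_unique (hsum.hasSum.comp hS) hlim⟩
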